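/- arXiv:2310.18666 — 2 statements merged into one kernel-verified Lean document; each statement's English description precedes it below -/
import Mathlib

section
/- Let d ≥ 1, α ∈ (0, 2), and ε > 0. Let g : ℝ^d → ℝ be four times continuously differentiable with g and all its partial derivatives up to order 4 bounded, and suppose |Δ(Δg)(x)| ≤ K for all x ∈ ℝ^d. For s > 0 define the heat semigroup (P_s g)(x) = ∫_{ℝ^d} (4πs)^{−d/2} exp(−‖y‖²/(4s)) g(x − y) dy, and set C(α, ε) = ε^{1 − α/2} / ((1 − α/2)·|Γ(−α/2)|). Then for every x ∈ ℝ^d, | (1/|Γ(−α/2)|) ∫_0^ε s^{−1−α/2} ((P_s g)(x) − g(x)) ds − C(α, ε)·Δg(x) | ≤ (K / (2(2 − α/2)|Γ(−α/2)|)) · ε^{2 − α/2}; in particular the truncated heat-semigroup representation of the fractional Laplacian equals C(α,ε)Δg(x) up to an error of order O(ε^{2−α/2}). -/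
open MeasureTheory Real

/-- The Laplacian of a function on `ℝ^d`: the sum of its second partial derivatives. -/
noncomputable def laplacian {d : ℕ} (f : EuclideanSpace ℝ (Fin d) → ℝ)
    (x : EuclideanSpace ℝ (Fin d)) : ℝ :=
  ∑ j : Fin d, fderiv ℝ (fun y => fderiv ℝ f y (EuclideanSpace.single j 1)) x
    (EuclideanSpace.single j 1)

/-- `f` is `n` times continuously differentiable with all derivatives up to order `n` bounded. -/
def BoundedContDiff {d : ℕ} (n : ℕ) (f : EuclideanSpace ℝ (Fin d) → ℝ) : Prop :=
  ContDiff ℝ n f ∧ ∀ i : ℕ, i ≤ n → ∃ C, ∀ x, ‖iteratedFDeriv ℝ i f x‖ ≤ C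

namespace BoundedContDiff

variable {d : ℕ} {n : ℕ} {f : EuclideanSpace ℝ (Fin d) → ℝ}

lemma mono {m : ℕ} (hf : BoundedContDiff n f) (h : m ≤ n) : BoundedContDiff m f :=
  ⟨hf.1.of_le (by exact_mod_cast h), fun i hi => hf.2 i (hi.trans h)⟩

lemma exists_abs_le (hf : BoundedContDiff n f) : ∃ C, ∀ x, |f x| ≤ C := by
  obtain ⟨C, hC⟩ := hf.2 0 (Nat.zero_le _)
  exact ⟨C, fun x => by simpa using hC x⟩

lemma exists_norm_fderiv_le (hf : BoundedContDiff (n + 1) f) : ∃ C, ∀ x, ‖fderiv ℝ f x‖ ≤ C := by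
  obtain ⟨C, hC⟩ := hf.2 1 (by omega)
  exact ⟨C, fun x => by simpa [norm_iteratedFDeriv_one] using hC x⟩

lemma fderiv_apply (hf : BoundedContDiff (n + 1) f) (v : EuclideanSpace ℝ (Fin d)) :
    BoundedContDiff n (fun y => fderiv ℝ f y v) := by
  have hD : ContDiff ℝ n (fderiv ℝ f) := hf.1.fderiv_right (by norm_cast)
  refine ⟨hD.clm_apply contDiff_const, fun i hi => ?_⟩
  obtain ⟨C, hC⟩ := hf.2 (i + 1) (by omega)
  refine ⟨‖v‖ * C, fun x => ?_⟩
  refine (norm_iteratedFDeriv_clm_apply_const hD.contDiffAt (by exact_mod_cast hi)).trans ?_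
  rw [norm_iteratedFDeriv_fderiv]
  gcongr
  exact hC x

lemma laplacian (hf : BoundedContDiff (n + 2) f) : BoundedContDiff n (laplacian f) := by
  have h (j : Fin d) := (hf.fderiv_apply (EuclideanSpace.single j 1)).fderiv_apply
    (EuclideanSpace.single j 1)
  refine ⟨ContDiff.sum fun j _ => (h j).1, fun i hi => ?_⟩
  choose C hC using fun j => (h j).2 i hi
  refine ⟨∑ j, C j, fun x => ?_⟩
  have := iteratedFDeriv_fun_sum_apply (𝕜 := ℝ) (u := Finset.univ) (n := i) (x := x)
    (fun j _ => ((h j).1.of_le (by exact_mod_cast hi)).contDiffAt)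
  change ‖iteratedFDeriv ℝ i (fun z => ∑ j, _) x‖ ≤ _
  rw [this]
  exact norm_sum_le_of_le _ fun j _ => hC j x

end BoundedContDiff

/-- The heat kernel at time one. -/
noncomputable def heatKernelOne {d : ℕ} (z : EuclideanSpace ℝ (Fin d)) : ℝ :=
  (4 * π) ^ (-(d : ℝ) / 2) * Real.exp (-‖z‖ ^ 2 / 4)

/-- The heat semigroup at time `r ^ 2`, applied to `f` and evaluated at `x`. -/
noncomputable def heatMean {d : ℕ} (f : EuclideanSpace ℝ (Fin d) → ℝ)
    (x : EuclideanSpace ℝ (Fin d)) (r : ℝ) : ℝ :=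
  ∫ z, heatKernelOne z * f (x - r • z)

section HeatKernel

variable {d : ℕ}

lemma heatKernelOne_pos (z : EuclideanSpace ℝ (Fin d)) : 0 < heatKernelOne z := by
  unfold heatKernelOne
  positivity

lemma continuous_heatKernelOne : Continuous (heatKernelOne (d := d)) := by
  unfold heatKernelOne
  fun_prop

lemma integrable_exp_neg_mul_norm_sq {b : ℝ} (hb : 0 < b) :
    Integrable (fun z : EuclideanSpace ℝ (Fin d) => Real.exp (-b * ‖z‖ ^ 2)) := by
  refine Integrable.of_integral_ne_zero ?_
  rw [GaussianFourier.integral_rexp_neg_mul_sq_norm hb]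
  positivity

lemma integral_heatKernelOne : ∫ z, heatKernelOne (d := d) z = 1 := by
  have h := GaussianFourier.integral_rexp_neg_mul_sq_norm (V := EuclideanSpace ℝ (Fin d))
    (b := 1 / 4) (by norm_num)
  unfold heatKernelOne
  rw [integral_const_mul]
  have e (z : EuclideanSpace ℝ (Fin d)) : -‖z‖ ^ 2 / 4 = -(1 / 4) * ‖z‖ ^ 2 := by ring
  simp_rw [e]
  rw [h, finrank_euclideanSpace_fin, neg_div, Real.rpow_neg (by positivity)]
  have : π / (1 / 4) = 4 * π := by ring
  rw [this]
  exact inv_mul_cancel₀ (by positivity)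

lemma integrable_one_add_norm_mul_heatKernelOne :
    Integrable (fun z : EuclideanSpace ℝ (Fin d) => (1 + ‖z‖) * heatKernelOne z) := by
  refine ((integrable_exp_neg_mul_norm_sq (d := d) (b := 1 / 8) (by norm_num)).const_mul
    (3 * (4 * π) ^ (-(d : ℝ) / 2))).mono'
    ((continuous_const.add continuous_norm).mul continuous_heatKernelOne).aestronglyMeasurable
    (Filter.Eventually.of_forall fun z => ?_)
  rw [Real.norm_of_nonneg (mul_nonneg (by positivity) (heatKernelOne_pos z).le), heatKernelOne]
  have h1 : Real.exp (-‖z‖ ^ 2 / 4)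
      = Real.exp (-(1 / 8) * ‖z‖ ^ 2) * Real.exp (-(1 / 8) * ‖z‖ ^ 2) := by
    rw [← Real.exp_add]; ring_nf
  have h2 : (1 + ‖z‖) * Real.exp (-(1 / 8) * ‖z‖ ^ 2) ≤ 3 := by
    have h3 := Real.add_one_le_exp (1 / 8 * ‖z‖ ^ 2)
    rw [neg_mul, Real.exp_neg, ← div_eq_mul_inv, div_le_iff₀ (Real.exp_pos _)]
    nlinarith [sq_nonneg (‖z‖ - 4 / 3)]
  calc (1 + ‖z‖) * ((4 * π) ^ (-(d : ℝ) / 2) * Real.exp (-‖z‖ ^ 2 / 4))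
      = ((1 + ‖z‖) * Real.exp (-(1 / 8) * ‖z‖ ^ 2)) * ((4 * π) ^ (-(d : ℝ) / 2)
        * Real.exp (-(1 / 8) * ‖z‖ ^ 2)) := by rw [h1]; ring
    _ ≤ 3 * ((4 * π) ^ (-(d : ℝ) / 2) * Real.exp (-(1 / 8) * ‖z‖ ^ 2)) := by gcongr
    _ = _ := by ring

lemma integrable_of_abs_le_heatKernelOne {F : EuclideanSpace ℝ (Fin d) → ℝ} (hF : Continuous F)
    {C : ℝ} (h : ∀ z, |F z| ≤ C * ((1 + ‖z‖) * heatKernelOne z)) : Integrable F :=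
  (integrable_one_add_norm_mul_heatKernelOne.const_mul C).mono' hF.aestronglyMeasurable
    (Filter.Eventually.of_forall h)

lemma integrable_heatKernelOne_mul {F : EuclideanSpace ℝ (Fin d) → ℝ} (hF : Continuous F)
    {C : ℝ} (h : ∀ z, |F z| ≤ C) : Integrable (fun z => heatKernelOne z * F z) := by
  refine integrable_of_abs_le_heatKernelOne (C := C) (continuous_heatKernelOne.mul hF) fun z => ?_
  have hφ := heatKernelOne_pos z
  have hC : 0 ≤ C := (abs_nonneg _).trans (h z)
  rw [abs_mul, abs_of_pos hφ]
  calc heatKernelOne z * |F z| ≤ heatKernelOne z * C := by gcongr; exact h z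
    _ = C * (1 * heatKernelOne z) := by ring
    _ ≤ C * ((1 + ‖z‖) * heatKernelOne z) := by gcongr; linarith [norm_nonneg z]

lemma hasFDerivAt_heatKernelOne (z : EuclideanSpace ℝ (Fin d)) :
    HasFDerivAt heatKernelOne ((-(heatKernelOne z / 2)) • innerSL ℝ z) z := by
  have h := ((((hasStrictFDerivAt_norm_sq z).hasFDerivAt.const_mul (-(1 / 4))).exp).const_mul
    ((4 * π) ^ (-(d : ℝ) / 2)))
  have e : (heatKernelOne (d := d)) = fun z => (4 * π) ^ (-(d : ℝ) / 2)
      * Real.exp (-(1 / 4) * ‖z‖ ^ 2) := by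
    funext z
    rw [heatKernelOne]
    congr 2
    ring
  rw [e]
  refine h.congr_fderiv ?_
  ext v
  simp
  ring

lemma fderiv_heatKernelOne_single (z : EuclideanSpace ℝ (Fin d)) (j : Fin d) :
    fderiv ℝ heatKernelOne z (EuclideanSpace.single j 1) = -(heatKernelOne z / 2) * z j := by
  rw [(hasFDerivAt_heatKernelOne z).fderiv]
  simp [EuclideanSpace.inner_single_right]

end HeatKernel

section HeatMean

variable {d : ℕ} {f : EuclideanSpace ℝ (Fin d) → ℝ}

lemma integral_heatKernelOne_mul_fderiv_single (hf : BoundedContDiff 2 f)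
    (x : EuclideanSpace ℝ (Fin d)) (r : ℝ) (j : Fin d) :
    Integrable (fun z => heatKernelOne z * (-z j *
        fderiv ℝ f (x - r • z) (EuclideanSpace.single j 1))) ∧
    ∫ z, heatKernelOne z * (-z j * fderiv ℝ f (x - r • z) (EuclideanSpace.single j 1))
      = 2 * r * ∫ z, heatKernelOne z * fderiv ℝ (fun y => fderiv ℝ f y (EuclideanSpace.single j 1))
        (x - r • z) (EuclideanSpace.single j 1) := by
  set e : EuclideanSpace ℝ (Fin d) := EuclideanSpace.single j 1
  have h1 : BoundedContDiff 1 (fun y => fderiv ℝ f y e) := hf.fderiv_apply e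
  have h0 : BoundedContDiff 0 (fun y => fderiv ℝ (fun y => fderiv ℝ f y e) y e) :=
    h1.fderiv_apply e
  have haff : Continuous fun z : EuclideanSpace ℝ (Fin d) => x - r • z := by fun_prop
  obtain ⟨C1, hC1⟩ := h1.exists_abs_le
  obtain ⟨C0, hC0⟩ := h0.exists_abs_le
  set G : EuclideanSpace ℝ (Fin d) → ℝ := fun z => fderiv ℝ f (x - r • z) e
  have hGd (z) : HasFDerivAt G ((-r) • fderiv ℝ (fun y => fderiv ℝ f y e) (x - r • z)) z := by
    have hd : HasFDerivAt (fun y => fderiv ℝ f y e)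
        (fderiv ℝ (fun y => fderiv ℝ f y e) (x - r • z)) (x - r • z) :=
      ((h1.1.differentiable (by simp)) _).hasFDerivAt
    have ha : HasFDerivAt (fun z : EuclideanSpace ℝ (Fin d) => x - r • z)
        (-(r • ContinuousLinearMap.id ℝ (EuclideanSpace ℝ (Fin d)))) z :=
      ((hasFDerivAt_id z).const_smul r).const_sub x
    refine (hd.comp z ha).congr_fderiv ?_
    ext v
    simp
  have hGc : Continuous G := h1.1.continuous.comp haff
  have hint : Integrable (fun z => heatKernelOne z * (-z j * G z)) := by
    refine integrable_of_abs_le_heatKernelOne (C := C1) (continuous_heatKernelOne.mul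
      (by fun_prop)) fun z => ?_
    have hφ := heatKernelOne_pos z
    have hz : |z j| ≤ 1 + ‖z‖ := by
      have := PiLp.norm_apply_le z j
      rw [Real.norm_eq_abs] at this
      linarith
    rw [abs_mul, abs_mul, abs_neg, abs_of_pos hφ]
    calc heatKernelOne z * (|z j| * |G z|) ≤ heatKernelOne z * ((1 + ‖z‖) * C1) := by
          gcongr
          exact hC1 _
      _ = _ := by ring
  refine ⟨hint, ?_⟩
  have hIBP := integral_mul_fderiv_eq_neg_fderiv_mul_of_integrable (μ := volume) (f := G)
    (g := heatKernelOne) (v := e) ?_ ?_ ?_ (fun z _ => (hGd z).differentiableAt)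
    (fun z _ => (hasFDerivAt_heatKernelOne z).differentiableAt)
  · have e1 (z) : G z * fderiv ℝ heatKernelOne z e
        = 2⁻¹ * (heatKernelOne z * (-z j * G z)) := by
      rw [fderiv_heatKernelOne_single]; ring
    have e2 (z) : fderiv ℝ G z e * heatKernelOne z = (-r) * (heatKernelOne z *
        fderiv ℝ (fun y => fderiv ℝ f y e) (x - r • z) e) := by
      rw [(hGd z).fderiv]
      simp
      ring
    simp_rw [e1, e2, integral_const_mul] at hIBP
    linarith
  · have := (integrable_heatKernelOne_mul (h0.1.continuous.comp haff)
      (fun z => hC0 (x - r • z))).const_mul (-r)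
    refine this.congr (Filter.Eventually.of_forall fun z => ?_)
    simp only [(hGd z).fderiv, Function.comp_apply, smul_apply, smul_eq_mul]
    ring
  · refine (hint.const_mul 2⁻¹).congr (Filter.Eventually.of_forall fun z => ?_)
    simp only [e, fderiv_heatKernelOne_single]
    ring
  · refine (integrable_heatKernelOne_mul hGc (fun z => hC1 (x - r • z))).congr
      (Filter.Eventually.of_forall fun z => mul_comm _ _)

lemma fderiv_apply_eq_sum (p z : EuclideanSpace ℝ (Fin d)) :
    fderiv ℝ f p z = ∑ j, z j * fderiv ℝ f p (EuclideanSpace.single j 1) := by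
  conv_lhs => rw [← (EuclideanSpace.basisFun (Fin d) ℝ).sum_repr z]
  simp [map_sum]

lemma hasDerivAt_heatMean (hf : BoundedContDiff 2 f) (x : EuclideanSpace ℝ (Fin d)) (r : ℝ) :
    HasDerivAt (heatMean f x) (2 * r * heatMean (laplacian f) x r) r := by
  obtain ⟨C, hC⟩ := hf.exists_abs_le
  obtain ⟨C1, hC1⟩ := hf.exists_norm_fderiv_le
  have hfc : Continuous f := hf.1.continuous
  have hDc : Continuous (fderiv ℝ f) := hf.1.continuous_fderiv (by simp)
  have hC1' : 0 ≤ C1 := (norm_nonneg _).trans (hC1 0)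
  have key := (hasDerivAt_integral_of_dominated_loc_of_deriv_le (μ := volume)
    (F := fun r z => heatKernelOne z * f (x - r • z))
    (F' := fun r z => heatKernelOne z * fderiv ℝ f (x - r • z) (-z)) (x₀ := r)
    (bound := fun z => C1 * ((1 + ‖z‖) * heatKernelOne z)) (s := Set.univ) Filter.univ_mem
    (Filter.Eventually.of_forall fun r =>
      (continuous_heatKernelOne.mul (by fun_prop)).aestronglyMeasurable)
    (integrable_heatKernelOne_mul (by fun_prop) fun z => hC _)
    (continuous_heatKernelOne.mul (by fun_prop)).aestronglyMeasurable
    (Filter.Eventually.of_forall fun z r _ => ?_)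
    (integrable_one_add_norm_mul_heatKernelOne.const_mul C1)
    (Filter.Eventually.of_forall fun z r _ => ?_)).2
  · refine key.congr_deriv ?_
    have hj := integral_heatKernelOne_mul_fderiv_single hf x r
    have hs (z : EuclideanSpace ℝ (Fin d)) : heatKernelOne z * fderiv ℝ f (x - r • z) (-z)
        = ∑ j, heatKernelOne z * (-z j *
          fderiv ℝ f (x - r • z) (EuclideanSpace.single j 1)) := by
      rw [fderiv_apply_eq_sum, Finset.mul_sum]
      rfl
    rw [integral_congr_ae (Filter.Eventually.of_forall hs),
      integral_finsetSum _ fun j _ => (hj j).1]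
    simp_rw [(hj _).2]
    rw [← Finset.mul_sum, heatMean]
    congr 1
    simp_rw [laplacian, Finset.mul_sum]
    refine (integral_finsetSum _ fun j _ => ?_).symm
    have h0 : BoundedContDiff 0 (fun y => fderiv ℝ
        (fun y => fderiv ℝ f y (EuclideanSpace.single j 1)) y (EuclideanSpace.single j 1)) :=
      (hf.fderiv_apply _).fderiv_apply _
    obtain ⟨C0, hC0⟩ := h0.exists_abs_le
    exact integrable_heatKernelOne_mul (h0.1.continuous.comp (by fun_prop)) fun z => hC0 (x - r • z)
  · have hφ := heatKernelOne_pos z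
    rw [norm_mul, Real.norm_of_nonneg hφ.le]
    have h1 : ‖fderiv ℝ f (x - r • z) (-z)‖ ≤ C1 * (1 + ‖z‖) := by
      refine (ContinuousLinearMap.le_opNorm _ _).trans ?_
      rw [norm_neg]
      gcongr
      · exact hC1 _
      · linarith
    calc _ ≤ heatKernelOne z * (C1 * (1 + ‖z‖)) := by gcongr
      _ = _ := by ring
  · have hd : HasFDerivAt f (fderiv ℝ f (x - r • z)) (x - r • z) :=
      (hf.1.differentiable (by simp) _).hasFDerivAt
    have ha : HasDerivAt (fun r : ℝ => x - r • z) (-z) r := by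
      simpa using ((hasDerivAt_id r).smul_const z).const_sub x
    exact (hd.comp_hasDerivAt r ha).const_mul _

lemma heatMean_zero (x : EuclideanSpace ℝ (Fin d)) : heatMean f x 0 = f x := by
  simp [heatMean, integral_mul_const, integral_heatKernelOne]

lemma abs_heatMean_le {K : ℝ} (hK : ∀ x, |f x| ≤ K) (x : EuclideanSpace ℝ (Fin d)) (r : ℝ) :
    |heatMean f x r| ≤ K := by
  have hφ : Integrable (heatKernelOne (d := d)) := by
    simpa using integrable_heatKernelOne_mul (d := d) (F := fun _ => 1) (C := 1)
      continuous_const (by simp)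
  have := norm_integral_le_of_norm_le (hφ.mul_const K)
    (f := fun z => heatKernelOne z * f (x - r • z)) (Filter.Eventually.of_forall fun z => by
      rw [norm_mul, Real.norm_of_nonneg (heatKernelOne_pos z).le]
      exact mul_le_mul_of_nonneg_left (hK _) (heatKernelOne_pos z).le)
  rwa [integral_mul_const, integral_heatKernelOne, one_mul] at this

lemma abs_heatMean_sub_le {K : ℝ} (hf : BoundedContDiff 2 f) (hK : ∀ x, |laplacian f x| ≤ K)
    (x : EuclideanSpace ℝ (Fin d)) {r : ℝ} (hr : 0 ≤ r) :
    |heatMean f x r - f x| ≤ K * r ^ 2 := by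
  have hd (t : ℝ) := (hasDerivAt_heatMean hf x t).sub_const (f x)
  refine image_norm_le_of_norm_deriv_right_le_deriv_boundary (a := 0) (b := r)
    (fun t _ => (hd t).continuousAt.continuousWithinAt) (fun t _ => (hd t).hasDerivWithinAt)
    (B := fun t => K * t ^ 2) (B' := fun t => K * (2 * t)) (by simp [heatMean_zero])
    (fun t => by simpa using (hasDerivAt_pow 2 t).const_mul K) (fun t ht => ?_)
    (Set.right_mem_Icc.2 hr)
  have h0 : 0 ≤ 2 * t := by linarith [ht.1]
  rw [norm_mul, Real.norm_of_nonneg h0, mul_comm]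
  gcongr
  exact abs_heatMean_le hK x t

lemma abs_heatMean_sub_sub_le {K : ℝ} (hf : BoundedContDiff 4 f)
    (hK : ∀ x, |laplacian (laplacian f) x| ≤ K)
    (x : EuclideanSpace ℝ (Fin d)) {r : ℝ} (hr : 0 ≤ r) :
    |heatMean f x r - f x - r ^ 2 * laplacian f x| ≤ K / 2 * r ^ 4 := by
  have hd (t : ℝ) := ((hasDerivAt_heatMean (hf.mono (by norm_num)) x t).sub_const (f x)).sub
    ((hasDerivAt_pow 2 t).mul_const (laplacian f x))
  refine image_norm_le_of_norm_deriv_right_le_deriv_boundary (a := 0) (b := r)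
    (fun t _ => (hd t).continuousAt.continuousWithinAt) (fun t _ => (hd t).hasDerivWithinAt)
    (B := fun t => K / 2 * t ^ 4) (B' := fun t => K / 2 * (4 * t ^ 3)) (by simp [heatMean_zero])
    (fun t => by simpa using (hasDerivAt_pow 4 t).const_mul (K / 2)) (fun t ht => ?_)
    (Set.right_mem_Icc.2 hr)
  have h0 : 0 ≤ 2 * t := by linarith [ht.1]
  have hL := abs_heatMean_sub_le (BoundedContDiff.laplacian (n := 2) hf) hK x ht.1
  calc _ = ‖2 * t * (heatMean (laplacian f) x t - laplacian f x)‖ := by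
        congr 1; push_cast; ring
    _ = 2 * t * |heatMean (laplacian f) x t - laplacian f x| := by
        rw [norm_mul, Real.norm_of_nonneg h0, Real.norm_eq_abs]
    _ ≤ 2 * t * (K * t ^ 2) := by gcongr
    _ = _ := by ring

lemma integral_heatKernel_mul_eq_heatMean (x : EuclideanSpace ℝ (Fin d)) {s : ℝ} (hs : 0 < s) :
    ∫ y, (4 * π * s) ^ (-(d : ℝ) / 2) * Real.exp (-‖y‖ ^ 2 / (4 * s)) * f (x - y)
      = heatMean f x (√s) := by
  have hs' : 0 < √s := Real.sqrt_pos.2 hs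
  have h := Measure.integral_comp_smul_of_nonneg (volume : Measure (EuclideanSpace ℝ (Fin d)))
    (fun y => (4 * π * s) ^ (-(d : ℝ) / 2) * Real.exp (-‖y‖ ^ 2 / (4 * s)) * f (x - y)) (√s)
    (hR := hs'.le)
  rw [finrank_euclideanSpace_fin, smul_eq_mul, eq_inv_mul_iff_mul_eq₀ (by positivity)] at h
  rw [← h, heatMean, ← integral_const_mul]
  congr 1
  funext z
  have e1 : -‖√s • z‖ ^ 2 / (4 * s) = -‖z‖ ^ 2 / 4 := by
    rw [norm_smul, Real.norm_of_nonneg hs'.le, mul_pow, Real.sq_sqrt hs.le]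
    field_simp
  have e2 : √s ^ d * (4 * π * s) ^ (-(d : ℝ) / 2) = (4 * π) ^ (-(d : ℝ) / 2) := by
    rw [Real.mul_rpow (by positivity) hs.le, Real.sqrt_eq_rpow, ← Real.rpow_natCast,
      ← Real.rpow_mul hs.le, mul_left_comm, ← Real.rpow_add hs]
    ring_nf
    simp
  rw [e1, heatKernelOne, ← e2]
  ring

end HeatMean

/-- Integrating the remainder of a first-order expansion at zero against `s ^ (-1 - a)`. -/
lemma abs_setIntegral_rpow_mul_sub_le {a ε K L : ℝ} (ha : a < 1) (hε : 0 < ε) {u : ℝ → ℝ}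
    (hu : ContinuousOn u (Set.Ioc 0 ε))
    (h : ∀ s ∈ Set.Ioc 0 ε, |u s - s * L| ≤ K / 2 * s ^ 2) :
    |(∫ s in Set.Ioc 0 ε, s ^ (-1 - a) * u s) - ε ^ (1 - a) / (1 - a) * L|
      ≤ K / (2 * (2 - a)) * ε ^ (2 - a) := by
  have hpow (b : ℝ) (hb : -1 < b) : IntegrableOn (fun s : ℝ => s ^ b) (Set.Ioc 0 ε) ∧
      ∫ s in Set.Ioc 0 ε, s ^ b = ε ^ (b + 1) / (b + 1) := by
    refine ⟨(intervalIntegrable_iff_integrableOn_Ioc_of_le hε.le).1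
      (intervalIntegral.intervalIntegrable_rpow' hb), ?_⟩
    rw [← intervalIntegral.integral_of_le hε.le, integral_rpow (Or.inl hb),
      Real.zero_rpow (by linarith), sub_zero]
  obtain ⟨hi1, he1⟩ := hpow (-a) (by linarith)
  obtain ⟨hi2, he2⟩ := hpow (1 - a) (by linarith)
  have hb : ∀ s ∈ Set.Ioc 0 ε, ‖s ^ (-1 - a) * (u s - s * L)‖ ≤ K / 2 * s ^ (1 - a) := by
    intro s hs
    have hp : 0 ≤ s ^ (-1 - a) := Real.rpow_nonneg hs.1.le _
    rw [norm_mul, Real.norm_of_nonneg hp, Real.norm_eq_abs]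
    calc _ ≤ s ^ (-1 - a) * (K / 2 * s ^ 2) := by gcongr; exact h s hs
      _ = K / 2 * (s ^ (-1 - a) * s ^ (2 : ℝ)) := by rw [Real.rpow_two]; ring
      _ = _ := by rw [← Real.rpow_add hs.1]; ring_nf
  have hc : ContinuousOn (fun s : ℝ => s ^ (-1 - a) * (u s - s * L)) (Set.Ioc 0 ε) :=
    (continuousOn_id.rpow_const fun s hs => Or.inl hs.1.ne').mul (hu.sub (by fun_prop))
  have hbae := (ae_restrict_iff' (μ := volume) (measurableSet_Ioc (a := 0) (b := ε))).2
    (Filter.Eventually.of_forall hb)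
  have hi3 : IntegrableOn (fun s : ℝ => s ^ (-1 - a) * (u s - s * L)) (Set.Ioc 0 ε) :=
    (hi2.const_mul (K / 2)).mono' (hc.aestronglyMeasurable measurableSet_Ioc) hbae
  have hsplit : ∫ s in Set.Ioc 0 ε, s ^ (-1 - a) * u s
      = (∫ s in Set.Ioc 0 ε, s ^ (-1 - a) * (u s - s * L))
        + ∫ s in Set.Ioc 0 ε, s ^ (-a) * L := by
    rw [← integral_add hi3 (hi1.mul_const L)]
    refine setIntegral_congr_fun measurableSet_Ioc fun s hs => ?_
    have : s ^ (-a) = s ^ (-1 - a) * s := by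
      rw [← Real.rpow_add_one hs.1.ne']; ring_nf
    simp only [this]
    ring
  have hle := norm_integral_le_of_norm_le (hi2.const_mul (K / 2)) hbae
  rw [hsplit, integral_mul_const, he1, neg_add_eq_sub, add_sub_cancel_right, ← Real.norm_eq_abs]
  refine hle.trans_eq ?_
  rw [integral_const_mul, he2]
  have e : 1 - a + 1 = 2 - a := by ring
  rw [e, div_mul_div_comm, div_mul_eq_mul_div]

/-- The truncated heat-semigroup representation of the fractional Laplacian equals
`C(α,ε) Δg(x)` up to an error of order `O(ε^{2−α/2})`. -/
theorem fractional_laplacian_truncation_bound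
    (d : ℕ) (hd : 1 ≤ d) (α ε K : ℝ) (hα : α ∈ Set.Ioo (0 : ℝ) 2) (hε : 0 < ε)
    (g : EuclideanSpace ℝ (Fin d) → ℝ)
    (hg : ContDiff ℝ 4 g)
    (hgb : ∀ i : ℕ, i ≤ 4 → ∃ C, ∀ x, ‖iteratedFDeriv ℝ i g x‖ ≤ C)
    (hK : ∀ x, |laplacian (laplacian g) x| ≤ K) :
    ∀ x : EuclideanSpace ℝ (Fin d),
      |(1 / |Real.Gamma (-α / 2)|) *
          (∫ s in Set.Ioc (0 : ℝ) ε, s ^ (-1 - α / 2) *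
            ((∫ y, (4 * π * s) ^ (-(d : ℝ) / 2)
              * Real.exp (-‖y‖ ^ 2 / (4 * s)) * g (x - y)) - g x))
        - (ε ^ (1 - α / 2) / ((1 - α / 2) * |Real.Gamma (-α / 2)|)) * laplacian g x|
      ≤ K / (2 * (2 - α / 2) * |Real.Gamma (-α / 2)|) * ε ^ (2 - α / 2) := by
  intro x
  have hB : BoundedContDiff 4 g := ⟨hg, hgb⟩
  have hcong : ∫ s in Set.Ioc (0 : ℝ) ε, s ^ (-1 - α / 2) *
            ((∫ y, (4 * π * s) ^ (-(d : ℝ) / 2)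
              * Real.exp (-‖y‖ ^ 2 / (4 * s)) * g (x - y)) - g x)
      = ∫ s in Set.Ioc (0 : ℝ) ε, s ^ (-1 - α / 2) * (heatMean g x (√s) - g x) :=
    setIntegral_congr_fun measurableSet_Ioc fun s hs => by
      simp only [integral_heatKernel_mul_eq_heatMean x hs.1]
  have hcont : Continuous (heatMean g x) := continuous_iff_continuousAt.2 fun r =>
    (hasDerivAt_heatMean (hB.mono (by norm_num)) x r).continuousAt
  have h := abs_setIntegral_rpow_mul_sub_le (a := α / 2) (K := K) (L := laplacian g x)
    (u := fun s => heatMean g x (√s) - g x) (by linarith [hα.2]) hε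
    (by fun_prop) fun s hs => by
      have := abs_heatMean_sub_sub_le hB hK x (Real.sqrt_nonneg s)
      rwa [show √s ^ 4 = (√s ^ 2) ^ 2 by ring, Real.sq_sqrt hs.1.le] at this
  rw [hcong]
  calc _ = |(1 / |Real.Gamma (-α / 2)|) *
          ((∫ s in Set.Ioc (0 : ℝ) ε, s ^ (-1 - α / 2) * (heatMean g x (√s) - g x))
            - ε ^ (1 - α / 2) / (1 - α / 2) * laplacian g x)| := by
        congr 1
        rw [← div_div]
        ring
    _ ≤ (1 / |Real.Gamma (-α / 2)|) * (K / (2 * (2 - α / 2)) * ε ^ (2 - α / 2)) := by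
        rw [abs_mul, abs_of_nonneg (by positivity)]
        gcongr
    _ = _ := by
        rw [← div_div K (2 * (2 - α / 2))]
        ring
end

section
/- Let d ≥ 1, h > 0, x_c ∈ ℝ^d, and 1 ≤ j ≤ d. Let Q_r and Q_l be the axis-aligned cubes of side length h centered at x_c + h·e_j and x_c − h·e_j respectively, where e_j is the j-th standard unit vector. Let U : ℝ^d → ℝ be twice continuously differentiable with the operator norm of its second derivative bounded by M on a convex set containing Q_r, Q_l, and x_c. Then | ( h^{−d} ∫_{Q_r} U(y) dy − h^{−d} ∫_{Q_l} U(y) dy ) / (2h) − ∂U/∂x_j (x_c) | ≤ M·h·(4 + d)/8; i.e. the central difference quotient of cell averages approximates the partial derivative ∂_j U(x_c) with error O(h). -/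
open MeasureTheory

section Taylor

variable {E : Type*} [NormedAddCommGroup E] [NormedSpace ℝ E]

theorem norm_fderiv_sub_le_of_norm_iteratedFDeriv_two_le {U : E → ℝ} {M : ℝ} {S : Set E}
    (hS : Convex ℝ S) (hU : ContDiff ℝ 2 U) (hM : ∀ y ∈ S, ‖iteratedFDeriv ℝ 2 U y‖ ≤ M)
    {x y : E} (hx : x ∈ S) (hy : y ∈ S) : ‖fderiv ℝ U y - fderiv ℝ U x‖ ≤ M * ‖y - x‖ := by
  have hd : Differentiable ℝ (fderiv ℝ U) :=
    (hU.fderiv_right (m := 1) (by norm_num)).differentiable (by norm_num)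
  refine hS.norm_image_sub_le_of_norm_fderiv_le (𝕜 := ℝ) (fun z _ => hd z) (fun z hz => ?_) hx hy
  rw [← norm_iteratedFDeriv_one, norm_iteratedFDeriv_fderiv]
  exact hM z hz

theorem abs_sub_sub_fderiv_le_of_norm_iteratedFDeriv_two_le {U : E → ℝ} {M : ℝ} {S : Set E}
    (hS : Convex ℝ S) (hU : ContDiff ℝ 2 U) (hM : ∀ y ∈ S, ‖iteratedFDeriv ℝ 2 U y‖ ≤ M)
    {x w : E} (hx : x ∈ S) (hy : x + w ∈ S) :
    |U (x + w) - U x - fderiv ℝ U x w| ≤ M / 2 * ‖w‖ ^ 2 := by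
  have hd : Differentiable ℝ U := hU.differentiable (by norm_num)
  have hline (t : ℝ) : HasDerivAt (fun t : ℝ => x + t • w) w t := by
    simpa using ((hasDerivAt_id t).smul_const w).const_add x
  have hf (t : ℝ) : HasDerivAt (fun t : ℝ => U (x + t • w) - U x - t * fderiv ℝ U x w)
      (fderiv ℝ U (x + t • w) w - fderiv ℝ U x w) t := by
    have h1 := (hd (x + t • w)).hasFDerivAt.comp_hasDerivAt t (hline t)
    exact ((h1.sub_const (U x)).sub
      ((hasDerivAt_id t).mul_const (fderiv ℝ U x w))).congr_deriv (by simp)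
  have hB (t : ℝ) : HasDerivAt (fun t : ℝ => M / 2 * ‖w‖ ^ 2 * t ^ 2) (M * ‖w‖ ^ 2 * t) t := by
    refine ((hasDerivAt_pow 2 t).const_mul (M / 2 * ‖w‖ ^ 2)).congr_deriv ?_
    push_cast
    ring
  have key := image_norm_le_of_norm_deriv_right_le_deriv_boundary (a := 0) (b := 1)
    (fun t _ => (hf t).continuousAt.continuousWithinAt)
    (fun t _ => (hf t).hasDerivWithinAt) (by simp) hB (fun t ht => ?_)
    (Set.right_mem_Icc.2 zero_le_one)
  · simpa using key
  · have hmem : x + t • w ∈ S := hS.add_smul_mem hx hy ⟨ht.1, ht.2.le⟩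
    have h1 := norm_fderiv_sub_le_of_norm_iteratedFDeriv_two_le hS hU hM hx hmem
    rw [add_sub_cancel_left, norm_smul, Real.norm_of_nonneg ht.1] at h1
    calc ‖fderiv ℝ U (x + t • w) w - fderiv ℝ U x w‖
        = ‖(fderiv ℝ U (x + t • w) - fderiv ℝ U x) w‖ := by simp
      _ ≤ M * (t * ‖w‖) * ‖w‖ := ContinuousLinearMap.le_of_opNorm_le _ h1 w
      _ = M * ‖w‖ ^ 2 * t := by ring

end Taylor

/-- The closed axis-aligned cube of side length `h` centered at the point `c`. -/
def euclideanCube {d : ℕ} (c : EuclideanSpace ℝ (Fin d)) (h : ℝ) :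
    Set (EuclideanSpace ℝ (Fin d)) :=
  {y | ∀ k : Fin d, c k - h / 2 ≤ y k ∧ y k ≤ c k + h / 2}

namespace euclideanCube

variable {d : ℕ} {h : ℝ}

theorem eq_preimage (c : EuclideanSpace ℝ (Fin d)) (h : ℝ) :
    euclideanCube c h = (WithLp.ofLp : EuclideanSpace ℝ (Fin d) → Fin d → ℝ) ⁻¹'
      Set.Icc (fun k => c k - h / 2) (fun k => c k + h / 2) := by
  ext y
  simp [euclideanCube, Pi.le_def, forall_and]

theorem isCompact (c : EuclideanSpace ℝ (Fin d)) (h : ℝ) : IsCompact (euclideanCube c h) := by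
  rw [eq_preimage]
  exact (PiLp.homeomorph 2 (fun _ : Fin d => ℝ)).isCompact_preimage.2 isCompact_Icc

theorem measureReal_eq (c : EuclideanSpace ℝ (Fin d)) (hh : 0 ≤ h) :
    volume.real (euclideanCube c h) = h ^ d := by
  rw [eq_preimage, Measure.real,
    (PiLp.volume_preserving_ofLp (Fin d)).measure_preimage measurableSet_Icc.nullMeasurableSet,
    Real.volume_Icc_pi]
  simp [hh]

theorem setIntegral_add_left (c : EuclideanSpace ℝ (Fin d)) (h : ℝ)
    (f : EuclideanSpace ℝ (Fin d) → ℝ) :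
    ∫ y in euclideanCube c h, f y = ∫ z in euclideanCube 0 h, f (c + z) := by
  rw [← (measurePreserving_add_left volume c).setIntegral_preimage_emb
    (measurableEmbedding_addLeft c)]
  congr 2
  ext z
  simp only [euclideanCube, Set.mem_preimage, Set.mem_ofPred_eq, PiLp.add_apply, PiLp.zero_apply]
  refine forall_congr' fun k => and_congr ?_ ?_ <;> constructor <;> intro _ <;> linarith

theorem setIntegral_neg (h : ℝ) (f : EuclideanSpace ℝ (Fin d) → ℝ) :
    ∫ z in euclideanCube 0 h, f (-z) = ∫ z in euclideanCube 0 h, f z := by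
  rw [← (Measure.measurePreserving_neg volume).setIntegral_preimage_emb
    (MeasurableEquiv.neg _).measurableEmbedding f]
  congr 2
  ext z
  simp only [euclideanCube, Set.mem_preimage, Set.mem_ofPred_eq, PiLp.neg_apply, PiLp.zero_apply]
  refine forall_congr' fun k => ?_
  constructor <;> rintro ⟨_, _⟩ <;> constructor <;> linarith

theorem setIntegral_clm_eq_zero (h : ℝ) (L : EuclideanSpace ℝ (Fin d) →L[ℝ] ℝ) :
    ∫ z in euclideanCube 0 h, L z = 0 := by
  have := setIntegral_neg h L
  simp only [map_neg, integral_neg] at this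
  linarith

theorem norm_sq_single_add_le {z : EuclideanSpace ℝ (Fin d)} (hz : z ∈ euclideanCube 0 h)
    (j : Fin d) :
    ‖h • EuclideanSpace.single j (1 : ℝ) + z‖ ^ 2 ≤ h ^ 2 * (1 + d / 4) + 2 * h * z j := by
  have hz2 : ‖z‖ ^ 2 ≤ d * (h ^ 2 / 4) := by
    rw [EuclideanSpace.real_norm_sq_eq]
    have hle : ∀ k ∈ (Finset.univ : Finset (Fin d)), z k ^ 2 ≤ h ^ 2 / 4 := fun k _ => by
      have := hz k
      simp only [PiLp.zero_apply] at this
      nlinarith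
    simpa using Finset.sum_le_card_nsmul _ _ _ hle
  have hn : ‖h • EuclideanSpace.single j (1 : ℝ)‖ ^ 2 = h ^ 2 := by
    simp [norm_smul]
  rw [norm_add_sq_real, hn, real_inner_smul_left, EuclideanSpace.inner_single_left]
  simp only [map_one, one_mul]
  linarith

end euclideanCube

/-- The central difference quotient of cell averages over cubes centered at
`x_c ± h e_j` approximates `∂U/∂x_j (x_c)` with error at most `M h (4 + d) / 8`. -/
theorem cell_average_central_difference
    (d : ℕ) (hd : 1 ≤ d) (h : ℝ) (hh : 0 < h)
    (xc : EuclideanSpace ℝ (Fin d)) (j : Fin d)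
    (U : EuclideanSpace ℝ (Fin d) → ℝ) (M : ℝ)
    (S : Set (EuclideanSpace ℝ (Fin d))) (hS : Convex ℝ S)
    (hQr : {y : EuclideanSpace ℝ (Fin d) | ∀ k : Fin d,
        (xc + h • EuclideanSpace.single j (1 : ℝ)) k - h / 2 ≤ y k ∧
        y k ≤ (xc + h • EuclideanSpace.single j (1 : ℝ)) k + h / 2} ⊆ S)
    (hQl : {y : EuclideanSpace ℝ (Fin d) | ∀ k : Fin d,
        (xc - h • EuclideanSpace.single j (1 : ℝ)) k - h / 2 ≤ y k ∧
        y k ≤ (xc - h • EuclideanSpace.single j (1 : ℝ)) k + h / 2} ⊆ S)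
    (hxc : xc ∈ S)
    (hU : ContDiff ℝ 2 U)
    (hM : ∀ y ∈ S, ‖iteratedFDeriv ℝ 2 U y‖ ≤ M) :
    |((∫ y in {y : EuclideanSpace ℝ (Fin d) | ∀ k : Fin d,
          (xc + h • EuclideanSpace.single j (1 : ℝ)) k - h / 2 ≤ y k ∧
          y k ≤ (xc + h • EuclideanSpace.single j (1 : ℝ)) k + h / 2}, U y) / h ^ d
        - (∫ y in {y : EuclideanSpace ℝ (Fin d) | ∀ k : Fin d,
          (xc - h • EuclideanSpace.single j (1 : ℝ)) k - h / 2 ≤ y k ∧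
          y k ≤ (xc - h • EuclideanSpace.single j (1 : ℝ)) k + h / 2}, U y) / h ^ d)
        / (2 * h)
      - fderiv ℝ U xc (EuclideanSpace.single j (1 : ℝ))|
      ≤ M * h * (4 + d) / 8 := by
  change |((∫ y in euclideanCube (xc + h • EuclideanSpace.single j (1 : ℝ)) h, U y) / h ^ d
    - (∫ y in euclideanCube (xc - h • EuclideanSpace.single j (1 : ℝ)) h, U y) / h ^ d)
    / (2 * h) - fderiv ℝ U xc (EuclideanSpace.single j (1 : ℝ))| ≤ _
  rw [euclideanCube.setIntegral_add_left (xc + _), euclideanCube.setIntegral_add_left (xc - _),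
    ← euclideanCube.setIntegral_neg h
      (fun z => U (xc - h • EuclideanSpace.single j (1 : ℝ) + z))]
  set e := EuclideanSpace.single j (1 : ℝ)
  set Q := euclideanCube (0 : EuclideanSpace ℝ (Fin d)) h
  set L := fderiv ℝ U xc
  have hQ : IsCompact Q := euclideanCube.isCompact 0 h
  have hvol : volume.real Q = h ^ d := euclideanCube.measureReal_eq 0 hh.le
  have hM0 : 0 ≤ M := (norm_nonneg _).trans (hM xc hxc)
  have hint {f : EuclideanSpace ℝ (Fin d) → ℝ} (hf : Continuous f) : IntegrableOn f Q :=
    hf.continuousOn.integrableOn_compact hQ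
  have hUc : Continuous U := hU.continuous
  have hbound : ∀ z ∈ Q, ‖U (xc + h • e + z) - U (xc - h • e + -z) - (2 * h * L e + 2 * L z)‖
      ≤ M * (h ^ 2 * (1 + d / 4)) + 2 * M * h * z j := by
    intro z hz
    have hr : xc + (h • e + z) ∈ S := hQr fun k => by
      have := hz k
      simp only [PiLp.zero_apply, PiLp.add_apply] at this ⊢
      constructor <;> linarith
    have hl : xc + -(h • e + z) ∈ S := hQl fun k => by
      have := hz k
      simp only [PiLp.zero_apply, PiLp.add_apply, PiLp.sub_apply, PiLp.neg_apply] at this ⊢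
      constructor <;> linarith
    have h1 := abs_sub_sub_fderiv_le_of_norm_iteratedFDeriv_two_le hS hU hM hxc hr
    have h2 := abs_sub_sub_fderiv_le_of_norm_iteratedFDeriv_two_le hS hU hM hxc hl
    have h3 := mul_le_mul_of_nonneg_left (euclideanCube.norm_sq_single_add_le hz j) hM0
    rw [norm_neg] at h2
    rw [Real.norm_eq_abs, show xc + h • e + z = xc + (h • e + z) by abel,
      show xc - h • e + -z = xc + -(h • e + z) by abel]
    simp only [map_neg, map_add, map_smul, smul_eq_mul] at h1 h2
    rw [abs_le] at h1 h2 ⊢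
    constructor <;> linarith [h1.1, h1.2, h2.1, h2.2]
  have hcoord : ∫ z in Q, z j = 0 :=
    euclideanCube.setIntegral_clm_eq_zero h (EuclideanSpace.proj j)
  have hL : ∫ z in Q, L z = 0 := euclideanCube.setIntegral_clm_eq_zero h L
  have key := norm_integral_le_of_norm_le (hint (by fun_prop))
    ((ae_restrict_iff' hQ.measurableSet).2 (ae_of_all volume hbound))
  rw [integral_sub (hint (by fun_prop)) (hint (by fun_prop)),
    integral_sub (hint (by fun_prop)) (hint (by fun_prop)),
    integral_add (hint (by fun_prop)) (hint (by fun_prop)),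
    integral_add (hint (by fun_prop)) (hint (by fun_prop)),
    integral_const_mul (2 : ℝ), integral_const_mul (2 * M * h), hcoord, hL, setIntegral_const, setIntegral_const, hvol,
    Real.norm_eq_abs] at key
  simp only [smul_eq_mul, mul_zero, add_zero] at key
  have hpos : 0 < h ^ d * (2 * h) := by positivity
  refine le_of_mul_le_mul_left ?_ hpos
  rw [← abs_of_pos hpos, ← abs_mul, abs_of_pos hpos]
  refine (le_of_eq ?_).trans (key.trans_eq (by ring))
  congr 1
  field_simp
end
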